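/- Let (M,d) be a cone metric space over a real Banach space E with cone P, and let S, T : M → M. If the pair (S,T) is a pair of generalized Zamfirescu operators (with some constants a, b, c), then (S,T) is a generalized weak contraction. -/

import Mathlib

/-- `P` is a cone in the real Banach space `E`. -/
def IsCone {E : Type*} [NormedAddCommGroup E] [NormedSpace ℝ E] (P : Set E) : Prop :=
  IsClosed P ∧ P.Nonempty ∧ P ≠ {0} ∧
    (∀ a b : ℝ, 0 ≤ a → 0 ≤ b → ∀ x ∈ P, ∀ y ∈ P, a • x + b • y ∈ P) ∧
    P ∩ (-P) = {0}

/-- The partial order induced by the cone `P`: `x ≤ y` iff `y - x ∈ P`. -/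
def ConeLe {E : Type*} [NormedAddCommGroup E] [NormedSpace ℝ E] (P : Set E) (x y : E) : Prop :=
  y - x ∈ P

/-- `x ≪ y` iff `y - x ∈ interior P`. -/
def ConeLt {E : Type*} [NormedAddCommGroup E] [NormedSpace ℝ E] (P : Set E) (x y : E) : Prop :=
  y - x ∈ interior P

/-- `P` is a normal cone with normal constant `K`. -/
def IsNormalCone {E : Type*} [NormedAddCommGroup E] [NormedSpace ℝ E] (P : Set E) (K : ℝ) : Prop :=
  0 < K ∧ ∀ x y : E, ConeLe P 0 x → ConeLe P x y → ‖x‖ ≤ K * ‖y‖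

/-- `d` is a cone metric on `M` with respect to the cone `P`. -/
def IsConeMetric {E M : Type*} [NormedAddCommGroup E] [NormedSpace ℝ E]
    (P : Set E) (d : M → M → E) : Prop :=
  (∀ x y : M, ConeLe P 0 (d x y)) ∧
  (∀ x y : M, d x y = 0 ↔ x = y) ∧
  (∀ x y : M, d x y = d y x) ∧
  (∀ x y z : M, ConeLe P (d x y) (d x z + d z y))

/-- Convergence of a sequence in a cone metric space. -/
def ConeConv {E M : Type*} [NormedAddCommGroup E] [NormedSpace ℝ E]
    (P : Set E) (d : M → M → E) (u : ℕ → M) (x : M) : Prop :=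
  ∀ c : E, ConeLt P 0 c → ∃ n₀ : ℕ, ∀ n ≥ n₀, ConeLt P (d (u n) x) c

/-- Cauchy sequences in a cone metric space. -/
def ConeCauchy {E M : Type*} [NormedAddCommGroup E] [NormedSpace ℝ E]
    (P : Set E) (d : M → M → E) (u : ℕ → M) : Prop :=
  ∀ c : E, ConeLt P 0 c → ∃ n₀ : ℕ, ∀ n ≥ n₀, ∀ m ≥ n₀, ConeLt P (d (u n) (u m)) c

/-- Completeness of a cone metric space. -/
def ConeComplete {E M : Type*} [NormedAddCommGroup E] [NormedSpace ℝ E]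
    (P : Set E) (d : M → M → E) : Prop :=
  ∀ u : ℕ → M, ConeCauchy P d u → ∃ x : M, ConeConv P d u x

/-- Sequential continuity of a self-map of a cone metric space. -/
def ConeSeqContinuous {E M : Type*} [NormedAddCommGroup E] [NormedSpace ℝ E]
    (P : Set E) (d : M → M → E) (T : M → M) : Prop :=
  ∀ (u : ℕ → M) (x : M), ConeConv P d u x → ConeConv P d (fun n => T (u n)) (T x)

/-- `(S, T)` is a pair of generalized Zamfirescu operators with constants `a`, `b`, `c`. -/
def IsGZO {E M : Type*} [NormedAddCommGroup E] [NormedSpace ℝ E]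
    (P : Set E) (d : M → M → E) (S T : M → M) (a b c : ℝ) : Prop :=
  0 ≤ a ∧ a < 1 ∧ 0 ≤ b ∧ b < 1/2 ∧ 0 ≤ c ∧ c < 1/2 ∧
    ∀ x y : M,
      ConeLe P (d (S x) (S y)) (a • d (T x) (T y)) ∨
      ConeLe P (d (S x) (S y)) (b • (d (S x) (T x) + d (S y) (T y))) ∨
      ConeLe P (d (S x) (S y)) (c • (d (S x) (T y) + d (S y) (T x)))

/-- `(S, T)` is a generalized weak contraction. -/
def IsGWC {E M : Type*} [NormedAddCommGroup E] [NormedSpace ℝ E]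
    (P : Set E) (d : M → M → E) (S T : M → M) : Prop :=
  ∃ δ L : ℝ, 0 < δ ∧ δ < 1 ∧ 0 ≤ L ∧
    ∀ x y : M, ConeLe P (d (S x) (S y)) (δ • d (T x) (T y) + L • d (S x) (T x))

theorem IsCone.add_mem {E : Type*} [NormedAddCommGroup E] [NormedSpace ℝ E] {P : Set E}
    (hP : IsCone P) {x y : E} (hx : x ∈ P) (hy : y ∈ P) : x + y ∈ P := by
  simpa using hP.2.2.2.1 1 1 zero_le_one zero_le_one x hx y hy

theorem IsCone.smul_mem {E : Type*} [NormedAddCommGroup E] [NormedSpace ℝ E] {P : Set E}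
    (hP : IsCone P) {r : ℝ} (hr : 0 ≤ r) {x : E} (hx : x ∈ P) : r • x ∈ P := by
  simpa using hP.2.2.2.1 r 0 hr le_rfl x hx x hx

/-- If `u ≤ k (u + t + 2 s)` with `k < 1/2`, then `u ≤ δ t + 2 s` for every `δ ≥ 2 k`. -/
theorem IsCone.le_of_le_smul_self_add {E : Type*} [NormedAddCommGroup E] [NormedSpace ℝ E]
    {P : Set E} (hP : IsCone P) {k δ : ℝ} (hk0 : 0 ≤ k) (hk : k < 1 / 2) (hδ : 2 * k ≤ δ)
    {u t s : E} (ht : t ∈ P) (hs : s ∈ P) (h : ConeLe P u (k • (u + t + (2 : ℝ) • s))) :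
    ConeLe P u (δ • t + (2 : ℝ) • s) := by
  have hpos : 0 < 1 - k := by linarith
  have hdiv : k / (1 - k) ≤ 2 * k := by
    rw [div_le_iff₀ hpos]
    nlinarith
  have key := hP.add_mem (hP.add_mem (hP.smul_mem (inv_nonneg.2 hpos.le) h)
    (hP.smul_mem (r := δ - k / (1 - k)) (by linarith) ht))
    (hP.smul_mem (r := 2 - 2 * (k / (1 - k))) (by linarith) hs)
  unfold ConeLe
  convert key using 1
  match_scalars <;> field_simp <;> ring

/-- A pair of generalized Zamfirescu operators is a generalized weak contraction. -/
theorem gwc_of_gzo {E M : Type*} [NormedAddCommGroup E] [NormedSpace ℝ E]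
    [CompleteSpace E] [Nonempty M]
    (P : Set E) (d : M → M → E)
    (hP : IsCone P) (hint : (interior P).Nonempty) (hd : IsConeMetric P d)
    (S T : M → M) (hGZO : ∃ a b c : ℝ, IsGZO P d S T a b c) :
    IsGWC P d S T := by
  obtain ⟨a, b, c, -, ha, hb0, hb, hc0, hc, h⟩ := hGZO
  obtain ⟨hnonneg, -, hsymm, htri⟩ := hd
  have hmem : ∀ x y, d x y ∈ P := fun x y => by simpa [ConeLe] using hnonneg x y
  obtain ⟨δ, hδ0, hδ1, haδ, hbδ, hcδ⟩ :
      ∃ δ : ℝ, 0 < δ ∧ δ < 1 ∧ a ≤ δ ∧ 2 * b ≤ δ ∧ 2 * c ≤ δ :=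
    ⟨max (max a (1 / 2)) (max (2 * b) (2 * c)), by simp,
      max_lt (max_lt ha (by norm_num)) (max_lt (by linarith) (by linarith)), by simp, by simp,
      by simp⟩
  refine ⟨δ, 2, hδ0, hδ1, zero_le_two, fun x y => ?_⟩
  have hTy : d (S x) (T x) + d (T x) (T y) - d (S x) (T y) ∈ P := htri _ _ _
  rcases h x y with h | h | h
  · have key := hP.add_mem (hP.add_mem h
      (hP.smul_mem (sub_nonneg.2 haδ) (hmem (T x) (T y))))
      (hP.smul_mem zero_le_two (hmem (S x) (T x)))
    unfold ConeLe
    convert key using 1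
    module
  · refine hP.le_of_le_smul_self_add hb0 hb hbδ (hmem _ _) (hmem _ _) ?_
    have hSy : d (S y) (S x) + d (S x) (T y) - d (S y) (T y) ∈ P := htri _ _ _
    rw [hsymm (S y) (S x)] at hSy
    have key := hP.add_mem h (hP.smul_mem hb0 (hP.add_mem hSy hTy))
    unfold ConeLe
    convert key using 1
    module
  · refine hP.le_of_le_smul_self_add hc0 hc hcδ (hmem _ _) (hmem _ _) ?_
    have hSy : d (S y) (S x) + d (S x) (T x) - d (S y) (T x) ∈ P := htri _ _ _
    rw [hsymm (S y) (S x)] at hSy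
    have key := hP.add_mem h (hP.smul_mem hc0 (hP.add_mem hSy hTy))
    unfold ConeLe
    convert key using 1
    module
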